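/- (Theorem 2: upper bound on the value of multistage stochastic programming.) Assume f_s ≥ 0 and c_s ≥ 0 componentwise for every stage s, λ_s ∈ [0,1] and α_s ∈ [0,1) for s = 2,…,T, and every B_s has nonnegative entries. Let (x^L, y^L, η^L, u^L) be an optimal solution of the LP relaxation of the multistage model (x^L : 𝒯 → ℝ^M, x^L_n ≥ 0), i.e. feasible for it with objective value ≤ that of every tuple feasible for it. Set b_n = B_{τ(n)} y^L_n, b̄_n = max_{l∈𝒯_{τ(n)}} b_l, and define: x^MS_r = b_r, x^MS_n = max_{m∈𝒫(n)} b_m − max_{m∈𝒫(a(n))} b_m (n ≠ r), η^MS_n = max_{m∈𝒞(n)} ( f_{τ(m)}·∑_{l∈𝒫(m)} x^MS_l + c_{τ(m)}·y^L_m − u^L_m ) (n ∉ ℒ); and x^TS_r = ⌈b̄_r⌉, x^TS_n = max_{m∈𝒫(n)} ⌈b̄_m⌉ − max_{m∈𝒫(a(n))} ⌈b̄_m⌉ (n ≠ r), η^TS_n = max_{m∈𝒞(n)} ( f_{τ(m)}·∑_{l∈𝒫(m)} x^TS_l + c_{τ(m)}·y^L_m − u^L_m ) (n ∉ ℒ).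 Let z^TS and z^MS be the infima of F over the two-stage-feasible and multistage-feasible tuples respectively (both real: the feasible sets are nonempty and F ≥ 0 on them). Then z^TS − z^MS ≤ f_1·( ⌈b_r⌉ − b_r ) + ∑_{n≠r} p_n (1−λ_{τ(n)}) f_{τ(n)} · ( max_{m∈𝒫(n)} ⌈b̄_m⌉ − max_{m∈𝒫(n)} b_m ) + ∑_{n∉ℒ} p_n λ_{τ(n)+1} ( η^TS_n − η^MS_n ). -/

import Mathlib

open Finset

/-- A scenario tree with `T` stages: a finite nonempty set of nodes with a root,
a parent map fixing the root, a stage map decreasing by one along the parent map,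
such that every node reaches the root by iterating the parent map, and every
non-leaf node has a child. -/
structure STree (T : ℕ) : Type 1 where
  Node : Type
  fin : Fintype Node
  deceq : DecidableEq Node
  root : Node
  parent : Node → Node
  stage : Node → ℕ
  hT : 1 ≤ T
  parent_root : parent root = root
  stage_root : stage root = 1
  stage_ge : ∀ n, 1 ≤ stage n
  stage_le : ∀ n, stage n ≤ T
  stage_parent : ∀ n, n ≠ root → stage (parent n) = stage n - 1
  reaches_root : ∀ n, ∃ k, parent^[k] n = root
  children_ne : ∀ n, stage n ≠ T → ∃ m, m ≠ root ∧ parent m = n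

attribute [instance] STree.fin STree.deceq

namespace STree

variable {T : ℕ} (S : STree T)

/-- The path set `𝒫(n) = {aᵏ(n) : k ≥ 0}` of a node. -/
def path (n : S.Node) : Finset S.Node :=
  (Finset.range T).image fun k => S.parent^[k] n

theorem path_nonempty (n : S.Node) : (S.path n).Nonempty :=
  ⟨n, Finset.mem_image.mpr ⟨0, Finset.mem_range.mpr S.hT, rfl⟩⟩

/-- The children `𝒞(n)` of a node. -/
def children (n : S.Node) : Finset S.Node :=
  Finset.univ.filter fun m => m ≠ S.root ∧ S.parent m = n

theorem children_nonempty {n : S.Node} (h : S.stage n ≠ T) : (S.children n).Nonempty := by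
  obtain ⟨m, h1, h2⟩ := S.children_ne n h
  exact ⟨m, Finset.mem_filter.mpr ⟨Finset.mem_univ m, h1, h2⟩⟩

/-- The set `𝒯ₛ` of stage-`s` nodes. -/
def stageNodes (s : ℕ) : Finset S.Node :=
  Finset.univ.filter fun n => S.stage n = s

theorem stageNodes_self_nonempty (n : S.Node) : (S.stageNodes (S.stage n)).Nonempty :=
  ⟨n, Finset.mem_filter.mpr ⟨Finset.mem_univ n, rfl⟩⟩

end STree

section Constructions

variable {T M J : ℕ}

/-- `b_n = B_{τ(n)} ŷ_n` (componentwise). -/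
noncomputable def bvec (S : STree T) (B : ℕ → Matrix (Fin M) (Fin J) ℝ)
    (yh : S.Node → Fin J → ℝ) (n : S.Node) (i : Fin M) : ℝ :=
  (B (S.stage n)).mulVec (yh n) i

/-- Componentwise maximum of `b` over all nodes of the same stage as `n`
(used for `b̄_n = max_{l ∈ 𝒯_{τ(n)}} b_l`). -/
noncomputable def stageMax (S : STree T) (b : S.Node → Fin M → ℝ) (n : S.Node) (i : Fin M) : ℝ :=
  (S.stageNodes (S.stage n)).sup' (S.stageNodes_self_nonempty n) fun l => b l i

/-- `max_{m ∈ 𝒫(n)} ⌈b_m⌉` (componentwise). -/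
noncomputable def pmc (S : STree T) (b : S.Node → Fin M → ℝ) (n : S.Node) (i : Fin M) : ℤ :=
  (S.path n).sup' (S.path_nonempty n) fun m => ⌈b m i⌉

/-- `max_{m ∈ 𝒫(n)} b_m` (componentwise, no rounding). -/
noncomputable def pm (S : STree T) (b : S.Node → Fin M → ℝ) (n : S.Node) (i : Fin M) : ℝ :=
  (S.path n).sup' (S.path_nonempty n) fun m => b m i

end Constructions

section CapacityModel

variable {T M N J : ℕ}

/-- Multistage feasibility (with the capacity variables `x` taken real, for LP
relaxations; the integer model uses the coercion of an integer `x`). -/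
def MFeasR (S : STree T) (f : ℕ → Fin M → ℝ) (c : ℕ → Fin J → ℝ)
    (A : ℕ → Matrix (Fin N) (Fin J) ℝ) (B : ℕ → Matrix (Fin M) (Fin J) ℝ)
    (d : S.Node → Fin N → ℝ)
    (x : S.Node → Fin M → ℝ) (y : S.Node → Fin J → ℝ) (η u : S.Node → ℝ) : Prop :=
  (∀ n i, 0 ≤ x n i) ∧ (∀ n j, 0 ≤ y n j) ∧ (∀ n, n ≠ S.root → 0 ≤ u n) ∧
  (∀ n, (A (S.stage n)).mulVec (y n) = d n) ∧
  (∀ n i, (B (S.stage n)).mulVec (y n) i ≤ ∑ m ∈ S.path n, x m i) ∧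
  ∀ n, n ≠ S.root →
    (∑ i, f (S.stage n) i * ∑ m ∈ S.path n, x m i) + (∑ j, c (S.stage n) j * y n j)
      ≤ u n + η (S.parent n)

/-- The two-stage (non-anticipativity) constraint: capacity decisions agree on
nodes of the same stage. -/
def TSconstr (S : STree T) (x : S.Node → Fin M → ℝ) : Prop :=
  ∀ m n, S.stage m = S.stage n → x m = x n

/-- The risk-averse objective
`F(x,y,η,u) = ∑_n p_n ( f̃_n·∑_{m∈𝒫(n)} x_m + c̃_n·y_n + λ̃_n η_n + α̃_n u_n )`,
where `f̃, c̃, λ̃, α̃` are the derived ECRM coefficients. -/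
noncomputable def FR (S : STree T) (p : S.Node → ℝ) (f : ℕ → Fin M → ℝ) (c : ℕ → Fin J → ℝ)
    (lam alpha : ℕ → ℝ)
    (x : S.Node → Fin M → ℝ) (y : S.Node → Fin J → ℝ) (η u : S.Node → ℝ) : ℝ :=
  ∑ n, p n *
    ((∑ i, (if n = S.root then f 1 i else (1 - lam (S.stage n)) * f (S.stage n) i)
        * ∑ m ∈ S.path n, x m i)
     + (∑ j, (if n = S.root then c 1 j else (1 - lam (S.stage n)) * c (S.stage n) j) * y n j)
     + (if S.stage n = T then 0 else lam (S.stage n + 1)) * η n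
     + (if n = S.root then 0 else lam (S.stage n) / (1 - alpha (S.stage n))) * u n)

/-- Optimal value of the risk-averse multistage model (integer capacities). -/
noncomputable def zMS (S : STree T) (p : S.Node → ℝ) (f : ℕ → Fin M → ℝ) (c : ℕ → Fin J → ℝ)
    (A : ℕ → Matrix (Fin N) (Fin J) ℝ) (B : ℕ → Matrix (Fin M) (Fin J) ℝ)
    (d : S.Node → Fin N → ℝ) (lam alpha : ℕ → ℝ) : ℝ :=
  sInf {v : ℝ | ∃ (x : S.Node → Fin M → ℤ) (y : S.Node → Fin J → ℝ) (η u : S.Node → ℝ),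
    MFeasR S f c A B d (fun n i => (x n i : ℝ)) y η u ∧
    v = FR S p f c lam alpha (fun n i => (x n i : ℝ)) y η u}

/-- Optimal value of the risk-averse two-stage model (integer capacities). -/
noncomputable def zTS (S : STree T) (p : S.Node → ℝ) (f : ℕ → Fin M → ℝ) (c : ℕ → Fin J → ℝ)
    (A : ℕ → Matrix (Fin N) (Fin J) ℝ) (B : ℕ → Matrix (Fin M) (Fin J) ℝ)
    (d : S.Node → Fin N → ℝ) (lam alpha : ℕ → ℝ) : ℝ :=
  sInf {v : ℝ | ∃ (x : S.Node → Fin M → ℤ) (y : S.Node → Fin J → ℝ) (η u : S.Node → ℝ),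
    MFeasR S f c A B d (fun n i => (x n i : ℝ)) y η u ∧
    TSconstr S (fun n i => (x n i : ℝ)) ∧
    v = FR S p f c lam alpha (fun n i => (x n i : ℝ)) y η u}

end CapacityModel

namespace STree

variable {T : ℕ} (S : STree T)

theorem eq_root_of_stage_eq_one {n : S.Node} (h : S.stage n = 1) : n = S.root := by
  by_contra hn
  have h1 := S.stage_parent n hn
  have h2 := S.stage_ge (S.parent n)
  omega

theorem node_induction {P : S.Node → Prop} (root : P S.root)
    (step : ∀ n, n ≠ S.root → P (S.parent n) → P n) (n : S.Node) : P n := by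
  induction hs : S.stage n generalizing n with
  | zero => have := S.stage_ge n; omega
  | succ k ih =>
    by_cases hn : n = S.root
    · exact hn ▸ root
    · exact step n hn (ih _ (by have := S.stage_parent n hn; omega))

theorem iterate_parent_root (k : ℕ) : S.parent^[k] S.root = S.root :=
  Function.iterate_fixed S.parent_root k

theorem iterate_parent_eq_root (n : S.Node) {k : ℕ} (hk : S.stage n ≤ k + 1) :
    S.parent^[k] n = S.root := by
  induction n using S.node_induction generalizing k with
  | root => exact S.iterate_parent_root k
  | step n hn ih =>
    have h1 := S.stage_parent n hn
    have h2 := S.stage_ge (S.parent n)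
    obtain ⟨j, rfl⟩ : ∃ j, k = j + 1 := ⟨k - 1, by omega⟩
    rw [Function.iterate_succ_apply]
    exact ih (by omega)

theorem path_root : S.path S.root = {S.root} := by
  ext m
  simp only [path, mem_image, mem_range, mem_singleton, S.iterate_parent_root]
  exact ⟨fun ⟨_, _, h⟩ => h.symm, fun h => ⟨0, S.hT, h.symm⟩⟩

theorem path_eq_insert (n : S.Node) :
    S.path n = insert n (S.path (S.parent n)) := by
  have hle := S.stage_le n
  have hT := S.hT
  ext m
  simp only [path, mem_image, mem_range, mem_insert, ← Function.iterate_succ_apply]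
  constructor
  · rintro ⟨k, hk, rfl⟩
    cases k with
    | zero => exact Or.inl rfl
    | succ k => exact Or.inr ⟨k, by omega, rfl⟩
  · rintro (rfl | ⟨k, hk, rfl⟩)
    · exact ⟨0, by omega, rfl⟩
    · by_cases h : k + 1 < T
      · exact ⟨k + 1, h, rfl⟩
      · exact ⟨T - 1, by omega, by
          rw [S.iterate_parent_eq_root n (by omega), S.iterate_parent_eq_root n (by omega)]⟩

theorem stage_le_of_mem_path {m n : S.Node} (h : m ∈ S.path n) : S.stage m ≤ S.stage n := by
  induction n using S.node_induction with
  | root => rw [S.path_root, mem_singleton] at h; rw [h]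
  | step n hn ih =>
    rw [S.path_eq_insert, mem_insert] at h
    rcases h with rfl | h
    · rfl
    · have := ih h
      have := S.stage_parent n hn
      omega

theorem notMem_path_parent {n : S.Node} (hn : n ≠ S.root) : n ∉ S.path (S.parent n) := by
  intro h
  have h1 := S.stage_le_of_mem_path h
  have h2 := S.stage_parent n hn
  have h3 := S.stage_ge n
  omega

theorem sum_path_of_ne_root {R : Type*} [AddCommMonoid R] {n : S.Node} (hn : n ≠ S.root)
    (x : S.Node → R) : ∑ m ∈ S.path n, x m = x n + ∑ m ∈ S.path (S.parent n), x m := by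
  rw [S.path_eq_insert, sum_insert (S.notMem_path_parent hn)]

theorem sum_path_telescope {R : Type*} [AddCommGroup R] {x g : S.Node → R}
    (hr : x S.root = g S.root) (hx : ∀ n, n ≠ S.root → x n = g n - g (S.parent n)) (n : S.Node) :
    ∑ m ∈ S.path n, x m = g n := by
  induction n using S.node_induction with
  | root => rw [S.path_root, sum_singleton, hr]
  | step n hn ih => rw [S.sum_path_of_ne_root hn, ih, hx n hn, sub_add_cancel]

theorem sup'_path {α : Type*} [LinearOrder α] (g : S.Node → α) (n : S.Node) :
    (S.path n).sup' (S.path_nonempty n) g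
      = max (g n) ((S.path (S.parent n)).sup' (S.path_nonempty _) g) := by
  rw [← sup'_insert]
  exact sup'_congr _ (S.path_eq_insert n) fun _ _ => rfl

theorem sup'_path_root {α : Type*} [LinearOrder α] (g : S.Node → α) :
    (S.path S.root).sup' (S.path_nonempty _) g = g S.root := by
  rw [sup'_congr (S.path_nonempty _) S.path_root fun _ _ => rfl]
  exact sup'_singleton g

theorem sup'_path_le_sum {x g : S.Node → ℝ} (hx : ∀ n, 0 ≤ x n)
    (hg : ∀ n, g n ≤ ∑ m ∈ S.path n, x m) (n : S.Node) :
    (S.path n).sup' (S.path_nonempty n) g ≤ ∑ m ∈ S.path n, x m := by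
  induction n using S.node_induction with
  | root => rw [S.sup'_path_root]; exact hg _
  | step n hn ih =>
    rw [S.sup'_path]
    refine max_le (hg n) (ih.trans ?_)
    rw [S.sum_path_of_ne_root hn]
    linarith [hx n]

theorem sup'_path_congr_stage {α : Type*} [LinearOrder α] {g : S.Node → α}
    (hg : ∀ m n, S.stage m = S.stage n → g m = g n) {m n : S.Node}
    (h : S.stage m = S.stage n) :
    (S.path m).sup' (S.path_nonempty m) g = (S.path n).sup' (S.path_nonempty n) g := by
  induction n using S.node_induction generalizing m with
  | root =>
    rw [S.stage_root] at h
    rw [S.eq_root_of_stage_eq_one h]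
  | step n hn ih =>
    have hm : m ≠ S.root := by
      rintro rfl
      exact hn (S.eq_root_of_stage_eq_one (h.symm.trans S.stage_root))
    rw [S.sup'_path, S.sup'_path g n, hg m n h, ih]
    rw [S.stage_parent m hm, S.stage_parent n hn, h]

theorem two_le_stage {n : S.Node} (hn : n ≠ S.root) : 2 ≤ S.stage n := by
  have := S.stage_ge n
  have : S.stage n ≠ 1 := fun h => hn (S.eq_root_of_stage_eq_one h)
  omega

theorem mem_children_parent {n : S.Node} (hn : n ≠ S.root) : n ∈ S.children (S.parent n) :=
  mem_filter.mpr ⟨mem_univ n, hn, rfl⟩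

theorem stage_parent_ne {n : S.Node} (hn : n ≠ S.root) : S.stage (S.parent n) ≠ T := by
  have := S.stage_parent n hn
  have := S.stage_le n
  have := S.stage_ge n
  omega

theorem stageNodes_one : S.stageNodes 1 = {S.root} := by
  ext n
  simp only [stageNodes, mem_filter, mem_univ, true_and, mem_singleton]
  exact ⟨S.eq_root_of_stage_eq_one, fun h => h ▸ S.stage_root⟩

end STree

section CapacityLemmas

variable {T M N J : ℕ} (S : STree T)

theorem stageMax_congr (b : S.Node → Fin M → ℝ) (i : Fin M) {m n : S.Node}
    (h : S.stage m = S.stage n) : stageMax S b m i = stageMax S b n i :=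
  sup'_congr _ (by rw [h]) fun _ _ => rfl

theorem le_stageMax (b : S.Node → Fin M → ℝ) (n : S.Node) (i : Fin M) :
    b n i ≤ stageMax S b n i :=
  le_sup' (s := S.stageNodes (S.stage n)) (fun l => b l i) (mem_filter.mpr ⟨mem_univ n, rfl⟩)

theorem stageMax_root (b : S.Node → Fin M → ℝ) (i : Fin M) :
    stageMax S b S.root i = b S.root i := by
  have h : S.stageNodes (S.stage S.root) = {S.root} := by rw [S.stage_root, S.stageNodes_one]
  exact (sup'_congr _ h fun _ _ => rfl).trans (sup'_singleton (fun l => b l i))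

theorem ceil_le_pmc (b : S.Node → Fin M → ℝ) (n : S.Node) (i : Fin M) :
    ⌈b n i⌉ ≤ pmc S b n i := by
  rw [pmc, S.sup'_path]; exact le_max_left _ _

theorem pmc_parent_le (b : S.Node → Fin M → ℝ) (n : S.Node) (i : Fin M) :
    pmc S b (S.parent n) i ≤ pmc S b n i := by
  rw [pmc, pmc, S.sup'_path _ n]; exact le_max_right _ _

theorem FR_mono {p : S.Node → ℝ} {f : ℕ → Fin M → ℝ} {c : ℕ → Fin J → ℝ} {lam alpha : ℕ → ℝ}
    (hp : ∀ n, 0 ≤ p n) (hf : ∀ s, 1 ≤ s → s ≤ T → ∀ i, 0 ≤ f s i)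
    (hlam : ∀ s, 2 ≤ s → s ≤ T → 0 ≤ lam s ∧ lam s ≤ 1)
    {x x' : S.Node → Fin M → ℝ} (y : S.Node → Fin J → ℝ) {η η' : S.Node → ℝ} (u : S.Node → ℝ)
    (hx : ∀ n i, ∑ m ∈ S.path n, x m i ≤ ∑ m ∈ S.path n, x' m i)
    (hη : ∀ n, S.stage n ≠ T → η n ≤ η' n) :
    FR S p f c lam alpha x y η u ≤ FR S p f c lam alpha x' y η' u := by
  refine sum_le_sum fun n _ => mul_le_mul_of_nonneg_left ?_ (hp n)
  have hle := S.stage_le n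
  have hge := S.stage_ge n
  gcongr ?_ + _ + ?_ + _
  · refine sum_le_sum fun i _ => mul_le_mul_of_nonneg_left (hx n i) ?_
    split_ifs with h
    · exact hf 1 le_rfl S.hT i
    · exact mul_nonneg (sub_nonneg.mpr (hlam _ (S.two_le_stage h) hle).2) (hf _ hge hle i)
  · split_ifs with h
    · simp
    · exact mul_le_mul_of_nonneg_left (hη n h) (hlam _ (by omega) (by omega)).1

theorem FR_sub_FR {p : S.Node → ℝ} (hpr : p S.root = 1) (f : ℕ → Fin M → ℝ) (c : ℕ → Fin J → ℝ)
    (lam alpha : ℕ → ℝ) (x x' : S.Node → Fin M → ℝ) (y : S.Node → Fin J → ℝ)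
    (η η' u : S.Node → ℝ) :
    FR S p f c lam alpha x y η u - FR S p f c lam alpha x' y η' u
      = (∑ i, f 1 i * (∑ m ∈ S.path S.root, x m i - ∑ m ∈ S.path S.root, x' m i))
        + (∑ n ∈ univ.filter (fun n => n ≠ S.root), p n * ((1 - lam (S.stage n)) *
              ∑ i, f (S.stage n) i * (∑ m ∈ S.path n, x m i - ∑ m ∈ S.path n, x' m i)))
        + (∑ n ∈ univ.filter (fun n => S.stage n ≠ T),
            p n * lam (S.stage n + 1) * (η n - η' n)) := by
  have hroot : (∑ i, f 1 i * (∑ m ∈ S.path S.root, x m i - ∑ m ∈ S.path S.root, x' m i))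
      = ∑ n, if n = S.root then
          ∑ i, f 1 i * (∑ m ∈ S.path n, x m i - ∑ m ∈ S.path n, x' m i) else 0 := by
    rw [sum_ite_eq' univ S.root]; simp
  rw [hroot, sum_filter, sum_filter, FR, FR, ← sum_sub_distrib, ← sum_add_distrib,
    ← sum_add_distrib]
  refine sum_congr rfl fun n _ => ?_
  simp only [mul_sub, sum_sub_distrib]
  by_cases hn : n = S.root
  · subst hn
    by_cases h : S.stage S.root = T <;> simp [hpr, h]
    ring
  · by_cases h : S.stage n = T <;> simp [hn, h, mul_assoc, ← mul_sum] <;> ring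

end CapacityLemmas

/-- Theorem 2: upper bound on the value of multistage stochastic
programming, built from an optimal solution `(x^L,y^L,η^L,u^L)` of the LP
relaxation of the multistage model. -/
theorem vms_upper_bound_LP {T M N J : ℕ} (S : STree T)
    (p : S.Node → ℝ) (f : ℕ → Fin M → ℝ) (c : ℕ → Fin J → ℝ)
    (A : ℕ → Matrix (Fin N) (Fin J) ℝ) (B : ℕ → Matrix (Fin M) (Fin J) ℝ)
    (d : S.Node → Fin N → ℝ) (lam alpha : ℕ → ℝ)
    (hp : ∀ n, 0 ≤ p n)
    (hp1 : ∀ s, 1 ≤ s → s ≤ T → ∑ n ∈ S.stageNodes s, p n = 1)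
    (hpc : ∀ n, S.stage n ≠ T → ∑ m ∈ S.children n, p m = p n)
    (hf : ∀ s, 1 ≤ s → s ≤ T → ∀ i, 0 ≤ f s i)
    (hc : ∀ s, 1 ≤ s → s ≤ T → ∀ j, 0 ≤ c s j)
    (hlam : ∀ s, 2 ≤ s → s ≤ T → 0 ≤ lam s ∧ lam s ≤ 1)
    (halpha : ∀ s, 2 ≤ s → s ≤ T → 0 ≤ alpha s ∧ alpha s < 1)
    (hB : ∀ s, 1 ≤ s → s ≤ T → ∀ i j, 0 ≤ B s i j)
    -- optimal solution of the LP relaxation of the multistage model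
    (xL : S.Node → Fin M → ℝ) (yL : S.Node → Fin J → ℝ) (etaL uL : S.Node → ℝ)
    (hLfeas : MFeasR S f c A B d xL yL etaL uL)
    (hLopt : ∀ (x : S.Node → Fin M → ℝ) (y : S.Node → Fin J → ℝ) (η u : S.Node → ℝ),
      MFeasR S f c A B d x y η u →
      FR S p f c lam alpha xL yL etaL uL ≤ FR S p f c lam alpha x y η u)
    -- nonemptiness of the (integer) feasible sets
    (hMne : ∃ (x : S.Node → Fin M → ℤ) (y : S.Node → Fin J → ℝ) (η u : S.Node → ℝ),
      MFeasR S f c A B d (fun n i => (x n i : ℝ)) y η u)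
    (hTne : ∃ (x : S.Node → Fin M → ℤ) (y : S.Node → Fin J → ℝ) (η u : S.Node → ℝ),
      MFeasR S f c A B d (fun n i => (x n i : ℝ)) y η u ∧
      TSconstr S (fun n i => (x n i : ℝ)))
    -- constructed multistage (fractional) and two-stage (integer) solutions
    (xMS : S.Node → Fin M → ℝ) (xTS : S.Node → Fin M → ℤ) (etaMS etaTS : S.Node → ℝ)
    (hxMSr : ∀ i, xMS S.root i = bvec S B yL S.root i)
    (hxMSn : ∀ n, n ≠ S.root → ∀ i,
      xMS n i = pm S (bvec S B yL) n i - pm S (bvec S B yL) (S.parent n) i)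
    (hxTSr : ∀ i, xTS S.root i = ⌈stageMax S (bvec S B yL) S.root i⌉)
    (hxTSn : ∀ n, n ≠ S.root → ∀ i,
      xTS n i = pmc S (stageMax S (bvec S B yL)) n i
              - pmc S (stageMax S (bvec S B yL)) (S.parent n) i)
    (hetaMS : ∀ n (hn : S.stage n ≠ T), etaMS n =
      (S.children n).sup' (S.children_nonempty hn) fun m =>
        (∑ i, f (S.stage m) i * ∑ l ∈ S.path m, xMS l i)
          + (∑ j, c (S.stage m) j * yL m j) - uL m)
    (hetaTS : ∀ n (hn : S.stage n ≠ T), etaTS n =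
      (S.children n).sup' (S.children_nonempty hn) fun m =>
        (∑ i, f (S.stage m) i * ∑ l ∈ S.path m, (xTS l i : ℝ))
          + (∑ j, c (S.stage m) j * yL m j) - uL m) :
    zTS S p f c A B d lam alpha - zMS S p f c A B d lam alpha
      ≤ (∑ i, f 1 i * ((⌈bvec S B yL S.root i⌉ : ℝ) - bvec S B yL S.root i))
        + (∑ n ∈ Finset.univ.filter (fun n => n ≠ S.root),
            p n * ((1 - lam (S.stage n)) *
              ∑ i, f (S.stage n) i *
                ((pmc S (stageMax S (bvec S B yL)) n i : ℝ) - pm S (bvec S B yL) n i)))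
        + (∑ n ∈ Finset.univ.filter (fun n => S.stage n ≠ T),
            p n * lam (S.stage n + 1) * (etaTS n - etaMS n)) := by
  have hpr : p S.root = 1 := by
    simpa [S.stageNodes_one] using hp1 1 le_rfl S.hT
  obtain ⟨hx0, hy0, hu0, hA, hcap, hexc⟩ := hLfeas
  have hb0 : ∀ n i, 0 ≤ bvec S B yL n i := fun n i => by
    rw [bvec, Matrix.mulVec]
    exact dotProduct_nonneg_of_nonneg (hB _ (S.stage_ge n) (S.stage_le n) i) (hy0 n)
  have hMSsum : ∀ n i, ∑ m ∈ S.path n, xMS m i = pm S (bvec S B yL) n i := fun n i =>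
    S.sum_path_telescope (x := fun m => xMS m i) (g := fun m => pm S (bvec S B yL) m i)
      ((hxMSr i).trans (S.sup'_path_root fun m => bvec S B yL m i).symm)
      (fun n hn => hxMSn n hn i) n
  have hTSr : ∀ i, pmc S (stageMax S (bvec S B yL)) S.root i
      = ⌈stageMax S (bvec S B yL) S.root i⌉ := fun i =>
    S.sup'_path_root fun m => ⌈stageMax S (bvec S B yL) m i⌉
  have hTSsum : ∀ n i, ∑ m ∈ S.path n, (xTS m i : ℝ)
      = (pmc S (stageMax S (bvec S B yL)) n i : ℝ) := fun n i => by
    exact_mod_cast S.sum_path_telescope (x := fun m => xTS m i)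
      (g := fun m => pmc S (stageMax S (bvec S B yL)) m i)
      ((hxTSr i).trans (hTSr i).symm) (fun n hn => hxTSn n hn i) n
  have hTSfeas : MFeasR S f c A B d (fun n i => (xTS n i : ℝ)) yL etaTS uL := by
    refine ⟨fun n i => ?_, hy0, hu0, hA, fun n i => ?_, fun n hn => ?_⟩
    · refine Int.cast_nonneg ?_
      by_cases hn : n = S.root
      · subst hn
        rw [hxTSr, stageMax_root]
        exact Int.ceil_nonneg (hb0 _ i)
      · rw [hxTSn n hn]
        exact sub_nonneg.mpr (pmc_parent_le S _ n i)
    · rw [hTSsum]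
      calc bvec S B yL n i ≤ stageMax S (bvec S B yL) n i := le_stageMax S _ n i
        _ ≤ ⌈stageMax S (bvec S B yL) n i⌉ := Int.le_ceil _
        _ ≤ _ := Int.cast_le.mpr (ceil_le_pmc S _ n i)
    · have h := le_sup' (fun m => (∑ i, f (S.stage m) i * ∑ l ∈ S.path m, (xTS l i : ℝ))
          + (∑ j, c (S.stage m) j * yL m j) - uL m) (S.mem_children_parent hn)
      rw [← hetaTS _ (S.stage_parent_ne hn)] at h
      linarith
  have hTScon : TSconstr S (fun n i => (xTS n i : ℝ)) := by
    intro m n h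
    funext i
    have hpmc : ∀ {m n : S.Node}, S.stage m = S.stage n →
        pmc S (stageMax S (bvec S B yL)) m i = pmc S (stageMax S (bvec S B yL)) n i :=
      fun h => S.sup'_path_congr_stage
        (fun m n h => by rw [stageMax_congr S _ i h]) h
    by_cases hn : n = S.root
    · subst hn
      rw [S.eq_root_of_stage_eq_one (h.trans S.stage_root)]
    · have hm : m ≠ S.root := by
        rintro rfl
        exact hn (S.eq_root_of_stage_eq_one (h.symm.trans S.stage_root))
      simp only [hxTSn n hn, hxTSn m hm, hpmc h,
        hpmc (show S.stage (S.parent m) = S.stage (S.parent n) by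
          rw [S.stage_parent m hm, S.stage_parent n hn, h])]
  have hMSle : ∀ n i, ∑ m ∈ S.path n, xMS m i ≤ ∑ m ∈ S.path n, xL m i := fun n i => by
    rw [hMSsum]
    exact S.sup'_path_le_sum (fun n => hx0 n i) (fun n => hcap n i) n
  have hetale : ∀ n, S.stage n ≠ T → etaMS n ≤ etaL n := by
    intro n hn
    rw [hetaMS n hn]
    refine sup'_le _ _ fun m hm => ?_
    obtain ⟨-, hmr, rfl⟩ := mem_filter.mp hm
    have h1 := hexc m hmr
    have h2 : (∑ i, f (S.stage m) i * ∑ l ∈ S.path m, xMS l i)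
        ≤ ∑ i, f (S.stage m) i * ∑ l ∈ S.path m, xL l i :=
      sum_le_sum fun i _ => mul_le_mul_of_nonneg_left (hMSle m i)
        (hf _ (S.stage_ge m) (S.stage_le m) i)
    linarith
  have hTSub : zTS S p f c A B d lam alpha
      ≤ FR S p f c lam alpha (fun n i => (xTS n i : ℝ)) yL etaTS uL := by
    refine csInf_le ⟨FR S p f c lam alpha xL yL etaL uL, ?_⟩
      ⟨xTS, yL, etaTS, uL, hTSfeas, hTScon, rfl⟩
    rintro v ⟨x, y, η, u, hfeas, -, rfl⟩
    exact hLopt _ _ _ _ hfeas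
  have hMSlb : FR S p f c lam alpha xL yL etaL uL ≤ zMS S p f c A B d lam alpha := by
    obtain ⟨x, y, η, u, hfeas⟩ := hMne
    refine le_csInf ⟨_, x, y, η, u, hfeas, rfl⟩ ?_
    rintro v ⟨x, y, η, u, hfeas, rfl⟩
    exact hLopt _ _ _ _ hfeas
  have hmono := FR_mono S (c := c) (alpha := alpha) hp hf hlam yL uL hMSle hetale
  refine le_of_le_of_eq (by linarith) ((FR_sub_FR S hpr f c lam alpha
    (fun n i => (xTS n i : ℝ)) xMS yL etaTS etaMS uL).trans ?_)
  simp only [hTSsum, hMSsum, hTSr, stageMax_root,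
    show ∀ i, pm S (bvec S B yL) S.root i = bvec S B yL S.root i from
      fun i => S.sup'_path_root fun m => bvec S B yL m i]
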